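/- Let Γ be a finite connected multigraph and let σ be a degree-d stability assignment for Γ. Then for every function m : Edges(Γ) → ℕ, the lift σ̃_m ⊆ S^d_{Γ̃_m}(Γ̃_m) is a minimal complete set of representatives for the action of the twister group tw(Γ̃_m) on S^d_{Γ̃_m}(Γ̃_m), i.e. every tw(Γ̃_m)-orbit in S^d_{Γ̃_m}(Γ̃_m) contains exactly one element of σ̃_m. -/

import Mathlib

open Finset

variable {V E : Type} [Fintype V] [Fintype E] [DecidableEq V] [DecidableEq E]

/-- The unordered pair of endpoints of an edge. -/
def eSym (ends : E → V × V) (e : E) : Sym2 V := s((ends e).1, (ends e).2)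

/-- Reachability in the spanning subgraph with edge set `A`. -/
def Linked (ends : E → V × V) (A : Finset E) : V → V → Prop :=
  Relation.ReflTransGen (fun v w => ∃ e ∈ A, eSym ends e = s(v, w))

/-- The spanning subgraph with edge set `A` is connected. -/
def Conn (ends : E → V × V) (A : Finset E) : Prop :=
  Nonempty V ∧ ∀ v w : V, Linked ends A v w

/-- The induced subgraph on the vertex set `W` is connected. -/
def ConnOn (ends : E → V × V) (W : Finset V) : Prop :=
  W.Nonempty ∧ ∀ v ∈ W, ∀ w ∈ W,
    Relation.ReflTransGen (fun a b => a ∈ W ∧ b ∈ W ∧ ∃ e : E, eSym ends e = s(a, b)) v w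

/-- A spanning tree: a connected spanning subgraph with `|V| - 1` edges. -/
def IsSpanningTree (ends : E → V × V) (A : Finset E) : Prop :=
  Conn ends A ∧ A.card + 1 = Fintype.card V

/-- The complexity of the spanning subgraph `A`: the number of its spanning trees. -/
noncomputable def complexity (ends : E → V × V) (A : Finset E) : ℕ :=
  Nat.card {T : Finset E // T ⊆ A ∧ IsSpanningTree ends T}

/-- `n(G)`: the number of edges of `Γ` missing from the spanning subgraph `G`. -/
def nG (A : Finset E) : ℕ := (Finset.univ \ A).card

/-- The space of multidegrees of total degree `d` at `A`. -/
def Sdeg (d : ℤ) (A : Finset E) : Set (V → ℤ) :=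
  {x | ∑ v, x v = d - (nG A : ℤ)}

/-- The twister at vertex `v` of the spanning subgraph with edge set `A`. -/
def twVec (ends : E → V × V) (A : Finset E) (v : V) : V → ℤ := fun w =>
  if w = v then
    -((A.filter (fun e => v ∈ eSym ends e ∧ ¬(eSym ends e).IsDiag)).card : ℤ)
  else ((A.filter (fun e => eSym ends e = s(v, w))).card : ℤ)

/-- The twister (chip-firing) group of the spanning subgraph with edge set `A`. -/
def twGroup (ends : E → V × V) (A : Finset E) : AddSubgroup (V → ℤ) :=
  AddSubgroup.closure (Set.range (twVec ends A))

/-- The standard basis vector at `v`. -/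
def stdVec (v : V) : V → ℤ := fun w => if w = v then 1 else 0

/-- A degree-`d` assignment: supported on connected spanning subgraphs, with the
prescribed total degree. -/
def IsAssignment (ends : E → V × V) (d : ℤ) (σ : Finset E → Set (V → ℤ)) : Prop :=
  ∀ A : Finset E, ∀ x ∈ σ A, Conn ends A ∧ x ∈ Sdeg d A

/-- Condition (1), chip-adding. -/
def ChipAdding (ends : E → V × V) (σ : Finset E → Set (V → ℤ)) : Prop :=
  ∀ A : Finset E, ∀ x ∈ σ A, ∀ e ∉ A, ∀ v ∈ eSym ends e, x + stdVec v ∈ σ (insert e A)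

/-- `S` is a minimal complete set of representatives for the action of the twister group
of `A` on the multidegree space `S^d(A)`. -/
def IsRepSet (ends : E → V × V) (d : ℤ) (A : Finset E) (S : Set (V → ℤ)) : Prop :=
  S ⊆ Sdeg d A ∧ ∀ x ∈ Sdeg (E := E) d A, ∃! y, y ∈ S ∧ x - y ∈ twGroup ends A

/-- A degree-`d` stability assignment. -/
def IsStabilityAssignment (ends : E → V × V) (d : ℤ) (σ : Finset E → Set (V → ℤ)) : Prop :=
  IsAssignment ends d σ ∧ ChipAdding ends σ ∧
    ∀ A : Finset E, Conn ends A → IsRepSet ends d A (σ A)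

/-- Vertices of the subdivision `Γ̃_m`: original vertices plus, for each edge `e`,
`m e` exceptional vertices. -/
abbrev SubV (V E : Type) (m : E → ℕ) : Type := V ⊕ (Σ e : E, Fin (m e))

/-- Edges of the subdivision `Γ̃_m`: each edge `e` is replaced by a chain of `m e + 1` edges. -/
abbrev SubE (E : Type) (m : E → ℕ) : Type := Σ e : E, Fin (m e + 1)

/-- The `i`-th vertex along the chain replacing the edge `e` in the subdivision. -/
def subNode (ends : E → V × V) (m : E → ℕ) (e : E) (i : ℕ) : SubV V E m :=
  if h0 : i = 0 then Sum.inl (ends e).1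
  else if h : i ≤ m e then Sum.inr ⟨e, ⟨i - 1, by omega⟩⟩
  else Sum.inl (ends e).2

/-- The endpoints of the edges of the subdivision `Γ̃_m`. -/
def subEnds (ends : E → V × V) (m : E → ℕ) : SubE E m → SubV V E m × SubV V E m :=
  fun p => (subNode ends m p.1 p.2.val, subNode ends m p.1 (p.2.val + 1))

/-- The lift of the multidegree `x` on `(A, Γ)`: extend by zero and add one chip on
the exceptional vertex `t e` of every removed edge `e ∉ A`. -/
def liftOf (m : E → ℕ) (A : Finset E) (x : V → ℤ) (t : E → ℕ) : SubV V E m → ℤ :=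
  Sum.elim x fun p => if p.1 ∉ A ∧ (p.2 : ℕ) = t p.1 then 1 else 0

/-- The lift `σ̃_m` of an assignment `σ`: all lifts of all elements of `σ`. -/
def liftSet (m : E → ℕ) (σ : Finset E → Set (V → ℤ)) : Set (SubV V E m → ℤ) :=
  {y | ∃ (A : Finset E) (x : V → ℤ) (t : E → ℕ),
    x ∈ σ A ∧ (∀ e ∉ A, t e < m e) ∧ y = liftOf m A x t}

/-- Edges with both endpoints in `W` (the edges of the induced subgraph `Γ(W)`). -/
def inE (ends : E → V × V) (W : Finset V) : Finset E :=
  Finset.univ.filter fun e => (ends e).1 ∈ W ∧ (ends e).2 ∈ W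

/-- Edges with one endpoint in `W` and the other in `Wᶜ`. -/
def cutE (ends : E → V × V) (W : Finset V) : Finset E :=
  Finset.univ.filter fun e =>
    ((ends e).1 ∈ W ∧ (ends e).2 ∉ W) ∨ ((ends e).1 ∉ W ∧ (ends e).2 ∈ W)

/-- `φ`-semistability of the multidegree `x` on the spanning subgraph `A`. -/
def PhiSemistable (ends : E → V × V) (φ : V → ℝ) (A : Finset E) (x : V → ℤ) : Prop :=
  ∀ W : Finset V, W.Nonempty → W ≠ Finset.univ →
    |(∑ v ∈ W, ((x v : ℝ) - φ v)) + (((Finset.univ \ A) ∩ inE ends W).card : ℝ) +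
        (((Finset.univ \ A) ∩ cutE ends W).card : ℝ) / 2| ≤
      ((A ∩ cutE ends W).card : ℝ) / 2

/-- `φ`-stability of the multidegree `x` on the spanning subgraph `A`. -/
def PhiStable (ends : E → V × V) (φ : V → ℝ) (A : Finset E) (x : V → ℤ) : Prop :=
  ∀ W : Finset V, W.Nonempty → W ≠ Finset.univ →
    |(∑ v ∈ W, ((x v : ℝ) - φ v)) + (((Finset.univ \ A) ∩ inE ends W).card : ℝ) +
        (((Finset.univ \ A) ∩ cutE ends W).card : ℝ) / 2| <
      ((A ∩ cutE ends W).card : ℝ) / 2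

/-- Nondegeneracy of a numerical polarization `φ`. -/
def Nondegenerate (ends : E → V × V) (d : ℤ) (φ : V → ℝ) : Prop :=
  ∀ A : Finset E, ∀ x ∈ Sdeg d A, PhiSemistable ends φ A x → PhiStable ends φ A x

/-- The assignment `stab_{Γ,φ}` associated with a numerical polarization `φ`. -/
def stabAssign (ends : E → V × V) (d : ℤ) (φ : V → ℝ) : Finset E → Set (V → ℤ) :=
  fun A => {x | Conn ends A ∧ x ∈ Sdeg d A ∧ PhiSemistable ends φ A x}

/-- The valence of the vertex `v` (loops counted twice). -/
def valence (ends : E → V × V) (v : V) : ℕ :=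
  ∑ e : E, ((if (ends e).1 = v then 1 else 0) + (if (ends e).2 = v then 1 else 0))

/-- `x` is an integral break divisor for the connected spanning subgraph `A`. -/
def isIBD (ends : E → V × V) (gen : V → ℕ) (A : Finset E) (x : V → ℤ) : Prop :=
  ∃ T : Finset E, T ⊆ A ∧ IsSpanningTree ends T ∧
    ∃ t : E → V, (∀ e ∈ A \ T, t e ∈ eSym ends e) ∧
      x = fun v => (gen v : ℤ) + (((A \ T).filter fun e => t e = v).card : ℤ)

/-- The multidegree `(a, b)` on a two-vertex graph with first vertex `v₁`. -/
def pairFn (v₁ : V) (a b : ℤ) : V → ℤ := fun w => if w = v₁ then a else b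

/-- The oriented incidence matrix: the column of `e` is `𝐞_{v₂} - 𝐞_{v₁}`. -/
def incMatrix (ends : E → V × V) : Matrix V E ℤ :=
  Matrix.of fun v e => stdVec (ends e).2 v - stdVec (ends e).1 v

/-- The boundary of an integral `1`-chain. -/
def boundary (ends : E → V × V) (s : E → ℤ) : V → ℤ := Matrix.mulVec (incMatrix ends) s

section Boundary

variable (ends : E → V × V)

lemma boundary_apply (s : E → ℤ) (v : V) :
    boundary ends s v = ∑ e, (stdVec (ends e).2 v - stdVec (ends e).1 v) * s e := rfl

lemma boundary_add (s t : E → ℤ) :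
    boundary ends (s + t) = boundary ends s + boundary ends t :=
  Matrix.mulVec_add _ s t

lemma boundary_sub (s t : E → ℤ) :
    boundary ends (s - t) = boundary ends s - boundary ends t :=
  Matrix.mulVec_sub _ s t

lemma boundary_zero : boundary ends (0 : E → ℤ) = 0 := Matrix.mulVec_zero _

lemma boundary_eq_sum (s : E → ℤ) :
    boundary ends s = ∑ e, s e • (stdVec (ends e).2 - stdVec (ends e).1) := by
  ext v
  simp [boundary_apply, Finset.sum_apply, mul_comm]

lemma sum_mul_stdVec (g : V → ℤ) (v : V) : ∑ w, g w * stdVec v w = g v := by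
  simp [stdVec]

lemma sum_mul_boundary (g : V → ℤ) (s : E → ℤ) :
    ∑ v, g v * boundary ends s v = ∑ e, s e * (g (ends e).2 - g (ends e).1) := by
  simp_rw [boundary_apply, Finset.mul_sum]
  rw [Finset.sum_comm]
  refine Finset.sum_congr rfl fun e _ => ?_
  rw [← sum_mul_stdVec g (ends e).2, ← sum_mul_stdVec g (ends e).1, ← Finset.sum_sub_distrib,
    Finset.mul_sum]
  exact Finset.sum_congr rfl fun v _ => by ring

lemma sum_boundary (s : E → ℤ) : ∑ v, boundary ends s v = 0 := by
  simpa using sum_mul_boundary ends 1 s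

/-- The integral gradient of a function, restricted to the edges of `A`. -/
def gradOn (A : Finset E) (f : V → ℤ) : E → ℤ :=
  fun e => if e ∈ A then f (ends e).1 - f (ends e).2 else 0

lemma gradOn_univ (f : V → ℤ) :
    gradOn ends univ f = fun e => f (ends e).1 - f (ends e).2 := by
  ext e; simp [gradOn]

lemma twVec_eq (A : Finset E) (v : V) :
    twVec ends A v = boundary ends (gradOn ends A (stdVec v)) := by
  ext w
  simp only [twVec, boundary_apply, gradOn, mul_ite, mul_zero, Finset.sum_ite_mem,
    Finset.univ_inter, Finset.card_filter, Nat.cast_sum]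
  split_ifs with h
  · subst h
    rw [← Finset.sum_neg_distrib]
    refine Finset.sum_congr rfl fun e _ => ?_
    simp only [stdVec, eSym, Sym2.mem_iff, Sym2.mk_isDiag_iff]
    rcases eq_or_ne w (ends e).1 with h1 | h1 <;> rcases eq_or_ne w (ends e).2 with h2 | h2
    · simp [← h1, ← h2]
    · simp [← h1, h2, h2.symm]
    · simp [← h2, h1, h1.symm]
    · simp [h1, h2, h1.symm, h2.symm]
  · refine Finset.sum_congr rfl fun e _ => ?_
    simp only [stdVec, eSym, Sym2.eq_iff]
    split_ifs <;> simp_all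

/-- The graph Laplacian of the spanning subgraph `A`, up to sign. -/
def lapHom (A : Finset E) : (V → ℤ) →+ (V → ℤ) where
  toFun f := boundary ends (gradOn ends A f)
  map_zero' := by
    have h : gradOn ends A (0 : V → ℤ) = 0 := by ext e; simp [gradOn]
    rw [h, boundary_zero]
  map_add' f g := by
    rw [← boundary_add]; congr 1; ext e
    simp only [gradOn, Pi.add_apply]; split_ifs <;> ring

lemma twGroup_eq_range (A : Finset E) : twGroup ends A = (lapHom ends A).range := by
  apply le_antisymm
  · rw [twGroup, AddSubgroup.closure_le]
    rintro _ ⟨v, rfl⟩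
    exact ⟨stdVec v, (twVec_eq ends A v).symm⟩
  · rintro _ ⟨f, rfl⟩
    have hf : f = ∑ v, f v • stdVec v := by
      ext w; simp [Finset.sum_apply, stdVec]
    rw [hf, map_sum]
    refine sum_mem fun v _ => ?_
    rw [map_zsmul]
    exact zsmul_mem (AddSubgroup.subset_closure (Set.mem_range.2 ⟨v, twVec_eq ends A v⟩)) _

lemma mem_twGroup_iff {A : Finset E} {x : V → ℤ} :
    x ∈ twGroup ends A ↔ ∃ f, x = boundary ends (gradOn ends A f) := by
  rw [twGroup_eq_range]
  exact ⟨fun ⟨f, hf⟩ => ⟨f, hf.symm⟩, fun ⟨f, hf⟩ => ⟨f, hf.symm⟩⟩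

variable {ends}

lemma eq_of_linked {α : Type*} {A : Finset E} {f : V → α}
    (hf : ∀ e ∈ A, f (ends e).1 = f (ends e).2) {v w : V} (h : Linked ends A v w) :
    f v = f w := by
  induction h with
  | refl => rfl
  | tail _ h ih =>
    obtain ⟨e, he, hs⟩ := h
    rw [ih]
    rcases Sym2.eq_iff.1 hs with ⟨h1, h2⟩ | ⟨h1, h2⟩
    · rw [← h1, ← h2, hf e he]
    · rw [← h1, ← h2, hf e he]

/-- The Laplacian of a connected graph kills only constants. -/
lemma eq_of_boundary_gradOn_eq_zero {A : Finset E} (hA : Conn ends A) {f : V → ℤ}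
    (hf : boundary ends (gradOn ends A f) = 0) (v w : V) : f v = f w := by
  refine eq_of_linked (fun e he => ?_) (hA.2 v w)
  have h := sum_mul_boundary ends f (gradOn ends A f)
  simp only [hf, Pi.zero_apply, mul_zero, Finset.sum_const_zero] at h
  have h' : ∑ e, gradOn ends A f e * gradOn ends A f e = 0 := by
    rw [← neg_eq_zero, ← Finset.sum_neg_distrib, h]
    refine Finset.sum_congr rfl fun e _ => ?_
    simp only [gradOn]; split_ifs <;> ring
  have := (Finset.sum_eq_zero_iff_of_nonneg fun e _ => mul_self_nonneg _).1 h' e (mem_univ e)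
  simpa [gradOn, he, sub_eq_zero] using this

/-- In a connected graph every degree-zero divisor is a boundary. -/
lemma exists_boundary_eq (hconn : Conn ends univ) {x : V → ℤ} (hx : ∑ v, x v = 0) :
    ∃ s, boundary ends s = x := by
  have key : ∀ v w : V, Linked ends univ v w → ∃ s, boundary ends s = stdVec w - stdVec v := by
    intro v w h
    induction h with
    | refl => exact ⟨0, by rw [boundary_zero, sub_self]⟩
    | tail _ h ih =>
      obtain ⟨s, hs⟩ := ih
      obtain ⟨e, -, he⟩ := h
      have h1 : boundary ends (Pi.single e 1) = stdVec (ends e).2 - stdVec (ends e).1 := by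
        rw [boundary_eq_sum, Finset.sum_eq_single e] <;> simp +contextual
      rcases Sym2.eq_iff.1 he with ⟨h1', h2⟩ | ⟨h1', h2⟩
      · exact ⟨s + Pi.single e 1, by rw [boundary_add, hs, h1, h1', h2]; abel⟩
      · exact ⟨s - Pi.single e 1, by rw [boundary_sub, hs, h1, h1', h2]; abel⟩
  obtain ⟨⟨v₀⟩, hl⟩ := hconn
  choose s hs using fun w => key v₀ w (hl v₀ w)
  refine ⟨∑ w, x w • s w, ?_⟩
  have h2 : boundary ends (∑ w, x w • s w) = ∑ w, x w • boundary ends (s w) := by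
    simp only [boundary, Matrix.mulVec_sum, Matrix.mulVec_smul]
  rw [h2]
  ext u
  simp only [hs, Finset.sum_apply, Pi.smul_apply, Pi.sub_apply, smul_sub, smul_eq_mul,
    Finset.sum_sub_distrib, ← Finset.sum_mul, hx, zero_mul, sub_zero]
  simp [stdVec]

end Boundary

section Codes

variable (ends : E → V × V)

/-- One chip on the second endpoint of every edge outside `A`. -/
def chipsOff (A : Finset E) : V → ℤ := ∑ e ∈ Aᶜ, stdVec (ends e).2

/-- The set of edges on which `q` vanishes. -/
def zeroSet (q : E → ℤ) : Finset E := univ.filter fun e => q e = 0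

@[simp] lemma mem_zeroSet {q : E → ℤ} {e : E} : e ∈ zeroSet q ↔ q e = 0 := by simp [zeroSet]

/-- The pairs `(X, q)` encoding the lifts of elements of `σ`: the edge `e` is removed if and only
if `q e ≠ 0`, its chip then lies at distance `q e` from the second endpoint, and `X` records the
multidegree obtained by moving all these chips to the second endpoints. -/
def IsCode (σ : Finset E → Set (V → ℤ)) (m : E → ℕ) (X : V → ℤ) (q : E → ℤ) : Prop :=
  (∀ e, 0 ≤ q e ∧ q e ≤ m e) ∧ X - chipsOff ends (zeroSet q) ∈ σ (zeroSet q)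

/-- The relation lattice on pairs `(X, q)` corresponding to the twister group of `Γ̃_m`. -/
def SubdivRel (m : E → ℕ) (X : V → ℤ) (q : E → ℤ) : Prop :=
  ∃ (f : V → ℤ) (s : E → ℤ), X = boundary ends s ∧
    ∀ e, q e = f (ends e).1 - f (ends e).2 + (m e + 1) * s e

variable {ends}

lemma SubdivRel.add {m : E → ℕ} {X X' : V → ℤ} {q q' : E → ℤ} (h : SubdivRel ends m X q)
    (h' : SubdivRel ends m X' q') : SubdivRel ends m (X + X') (q + q') := by
  obtain ⟨f, s, hs, hq⟩ := h
  obtain ⟨f', s', hs', hq'⟩ := h'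
  refine ⟨f + f', s + s', by rw [boundary_add, hs, hs'], fun e => ?_⟩
  simp only [Pi.add_apply, hq, hq']; ring

lemma SubdivRel.neg {m : E → ℕ} {X : V → ℤ} {q : E → ℤ} (h : SubdivRel ends m X q) :
    SubdivRel ends m (-X) (-q) := by
  obtain ⟨f, s, hs, hq⟩ := h
  refine ⟨-f, -s, by rw [hs, boundary, boundary, Matrix.mulVec_neg], fun e => ?_⟩
  simp only [Pi.neg_apply, hq]; ring

lemma add_sum_stdVec_mem {σ : Finset E → Set (V → ℤ)} (hσ : ChipAdding ends σ) {A : Finset E}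
    {x : V → ℤ} (hx : x ∈ σ A) {w : E → V} (C : Finset E)
    (hC : ∀ e ∈ C, e ∉ A ∧ w e ∈ eSym ends e) : x + ∑ e ∈ C, stdVec (w e) ∈ σ (C ∪ A) := by
  induction C using Finset.induction_on with
  | empty => simpa using hx
  | insert e C he ih =>
    have h := hσ _ _ (ih fun e' he' => hC e' (mem_insert_of_mem he')) e
      (by simp [he, (hC e (mem_insert_self e C)).1]) _ (hC e (mem_insert_self e C)).2
    rw [Finset.insert_union, Finset.sum_insert he, add_comm (stdVec (w e)), ← add_assoc]
    exact h

lemma add_boundary_mem {σ : Finset E → Set (V → ℤ)} (hσ : ChipAdding ends σ) {A B : Finset E}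
    (hAB : A ⊆ B) {X : V → ℤ} (hX : X - chipsOff ends A ∈ σ A) {ε : E → ℤ}
    (hε : ∀ e, ε e = 0 ∨ ε e = -1 ∧ e ∈ B ∧ e ∉ A) :
    X + boundary ends ε - chipsOff ends B ∈ σ B := by
  have h := add_sum_stdVec_mem hσ hX
    (w := fun e => if ε e = -1 then (ends e).1 else (ends e).2) (B \ A) (fun e he => by
      refine ⟨(mem_sdiff.1 he).2, ?_⟩
      split_ifs <;> simp [eSym])
  rw [Finset.sdiff_union_of_subset hAB] at h
  convert h using 1
  have h1 : chipsOff ends A = chipsOff ends B + ∑ e ∈ B \ A, stdVec (ends e).2 := by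
    have h3 : Aᶜ = Bᶜ ∪ B \ A := by
      ext e
      have := @hAB e
      simp only [mem_compl, mem_union, mem_sdiff]; tauto
    rw [chipsOff, chipsOff, h3, Finset.sum_union]
    rw [Finset.disjoint_left]
    intro e; simp +contextual
  have h2 : boundary ends ε = ∑ e ∈ B \ A, ε e • (stdVec (ends e).2 - stdVec (ends e).1) := by
    rw [boundary_eq_sum]
    refine (Finset.sum_subset (subset_univ _) fun e _ he => ?_).symm
    rcases hε e with h0 | h0
    · simp [h0]
    · exact absurd (mem_sdiff.2 h0.2) he
  have h4 : ∑ e ∈ B \ A, stdVec (if ε e = -1 then (ends e).1 else (ends e).2) =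
      ∑ e ∈ B \ A, stdVec (ends e).2 +
        ∑ e ∈ B \ A, ε e • (stdVec (ends e).2 - stdVec (ends e).1) := by
    rw [← Finset.sum_add_distrib]
    refine Finset.sum_congr rfl fun e _ => ?_
    rcases hε e with h0 | ⟨h0, -⟩ <;> simp [h0]
  rw [h4, h1, h2]
  abel

lemma chipsOff_univ : chipsOff ends univ = 0 := by simp [chipsOff]

lemma IsCode.add_boundary_mem_univ {σ : Finset E → Set (V → ℤ)} (hσ : ChipAdding ends σ)
    {m : E → ℕ} {X : V → ℤ} {q : E → ℤ} (h : IsCode ends σ m X q) {ε : E → ℤ}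
    (hε : ∀ e, ε e = 0 ∨ ε e = -1 ∧ q e ≠ 0) : X + boundary ends ε ∈ σ univ := by
  have := add_boundary_mem hσ (subset_univ _) h.2 (ε := ε) (by simpa using hε)
  rwa [chipsOff_univ, sub_zero] at this

/-- If two elements of `σ univ` differ by a Laplacian, then the function is constant. -/
lemma eq_of_mem_univ {d : ℤ} {σ : Finset E → Set (V → ℤ)} (hconn : Conn ends univ)
    (hσ : IsStabilityAssignment ends d σ) {X X' : V → ℤ} (hX : X ∈ σ univ) (hX' : X' ∈ σ univ)
    {g : V → ℤ} (h : X - X' = boundary ends (gradOn ends univ g)) (v w : V) : g v = g w := by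
  obtain ⟨hs, hu⟩ := hσ.2.2 univ hconn
  have hXX : X = X' := (hu X (hs hX)).unique ⟨hX, by simp⟩
    ⟨hX', (mem_twGroup_iff ends).2 ⟨g, h⟩⟩
  exact eq_of_boundary_gradOn_eq_zero hconn (by rw [← h, hXX, sub_self]) v w

/-- On the uniform subdivision into four segments, different lifts are inequivalent. -/
lemma IsCode.eq_of_rel {d : ℤ} {σ : Finset E → Set (V → ℤ)} (hconn : Conn ends univ)
    (hσ : IsStabilityAssignment ends d σ) {X X' : V → ℤ} {q q' : E → ℤ}
    (h : IsCode ends σ (fun _ => 3) X q) (h' : IsCode ends σ (fun _ => 3) X' q')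
    (hrel : SubdivRel ends (fun _ => 3) (X - X') (q - q')) : X = X' ∧ q = q' := by
  obtain ⟨f, s, hs, hq⟩ := hrel
  simp only [Pi.sub_apply, Nat.cast_ofNat] at hq
  have hb : ∀ e, 0 ≤ q e ∧ q e ≤ 3 := by simpa using h.1
  have hb' : ∀ e, 0 ≤ q' e ∧ q' e ≤ 3 := by simpa using h'.1
  have hconst : ∀ v w, f v = f w := by
    have hr : ∀ (r : ℤ) v w, (f v + r) / 4 = (f w + r) / 4 := by
      intro r
      refine eq_of_mem_univ hconn hσ (g := fun v => (f v + r) / 4)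
        (h'.add_boundary_mem_univ hσ.2.1 (ε := fun e => if q e < q' e then
          s e + ((f (ends e).1 + r) / 4 - (f (ends e).2 + r) / 4) else 0) fun e => ?_)
        (h.add_boundary_mem_univ hσ.2.1 (ε := fun e => if q' e < q e then
          -(s e + ((f (ends e).1 + r) / 4 - (f (ends e).2 + r) / 4)) else 0) fun e => ?_) ?_
      · have := hb e; have := hb' e; have := hq e
        split_ifs <;> omega
      · have := hb e; have := hb' e; have := hq e
        split_ifs <;> omega
      · rw [eq_add_of_sub_eq hs, add_sub_add_comm, add_comm (boundary ends s), sub_add_cancel_left,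
          ← sub_eq_neg_add, ← boundary_sub, ← boundary_sub, gradOn_univ]
        congr 1
        ext e
        have := hb e; have := hb' e; have := hq e
        simp only [Pi.sub_apply]
        split_ifs <;> omega
    intro v w
    have h1 := hr (-f v) v w
    have h2 := hr (-f w) v w
    omega
  have hq' : ∀ e, q e = q' e ∧ s e = 0 := by
    intro e
    have := hb e; have := hb' e; have := hq e; have := hconst (ends e).1 (ends e).2
    omega
  refine ⟨?_, funext fun e => (hq' e).1⟩
  rw [← sub_eq_zero, hs, show s = 0 from funext fun e => (hq' e).2, boundary_zero]

end Codes

section Completeness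

variable {ends : E → V × V} {d : ℤ} {σ : Finset E → Set (V → ℤ)}

lemma sum_chipsOff (A : Finset E) : ∑ v, chipsOff ends A v = nG A := by
  simp only [chipsOff, Finset.sum_apply, nG]
  rw [Finset.sum_comm, Finset.compl_eq_univ_sdiff]
  simp [stdVec]

lemma IsCode.sum_eq (hσ : IsAssignment ends d σ) {m : E → ℕ} {X : V → ℤ} {q : E → ℤ}
    (h : IsCode ends σ m X q) : ∑ v, X v = d := by
  have h1 : ∑ v, (X - chipsOff ends (zeroSet q)) v = d - nG (zeroSet q) := (hσ _ _ h.2).2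
  simp only [Pi.sub_apply, Finset.sum_sub_distrib, sum_chipsOff] at h1
  linarith

/-- A chip that has moved past the last exceptional vertex is absorbed by the first endpoint. -/
lemma exists_isCode_of_le_add_one (hσ : ChipAdding ends σ) {m : E → ℕ} {A : Finset E} {X : V → ℤ}
    (hX : X - chipsOff ends A ∈ σ A) {q : E → ℤ} (hq : ∀ e, 0 ≤ q e ∧ q e ≤ m e + 1)
    (hA : ∀ e ∈ A, q e = 0) :
    ∃ X' q', IsCode ends σ m X' q' ∧ SubdivRel ends m (X - X') (q - q') := by
  refine ⟨X + boundary ends (fun e => if q e = m e + 1 then -1 else 0),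
    fun e => if q e = m e + 1 then 0 else q e, ⟨fun e => ?_, ?_⟩, 0,
    fun e => if q e = m e + 1 then 1 else 0, ?_, fun e => ?_⟩
  · have := hq e
    dsimp only
    split_ifs <;> omega
  · refine add_boundary_mem hσ (fun e he => ?_) hX fun e => ?_
    · simp [hA e he]
    · by_cases h : q e = m e + 1
      · refine Or.inr ⟨by simp [h], by simp [h], fun he => ?_⟩
        have := hA e he
        omega
      · simp [h]
  · rw [sub_add_cancel_left, boundary, boundary, ← Matrix.mulVec_neg]
    congr 1
    ext e
    simp only [Pi.neg_apply]
    split_ifs <;> rfl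
  · simp only [Pi.sub_apply, Pi.zero_apply, sub_zero, zero_add]
    split_ifs with h <;> simp [h]

/-- Lifts can be moved by one step along each edge, provided that the lifts to the uniform
subdivision into four segments represent all classes. -/
lemma IsCode.exists_step (hconn : Conn ends univ) (hσ : IsStabilityAssignment ends d σ)
    (hc : ∀ (X : V → ℤ) (q : E → ℤ), ∑ v, X v = d → ∃ X' q',
      IsCode ends σ (fun _ => 3) X' q' ∧ SubdivRel ends (fun _ => 3) (X - X') (q - q'))
    {m : E → ℕ} {X : V → ℤ} {q : E → ℤ} (h : IsCode ends σ m X q) (e₀ : E) :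
    ∃ X' q', IsCode ends σ m X' q' ∧
      SubdivRel ends m (X - X') (q + Pi.single e₀ 1 - q') := by
  by_cases he₀ : q e₀ = 0
  swap
  · refine exists_isCode_of_le_add_one hσ.2.1 h.2 (fun e => ?_) fun e he => ?_
    · have := h.1 e
      rw [Pi.add_apply, Pi.single_apply]
      split_ifs <;> omega
    · have h0 : e ≠ e₀ := by rintro rfl; exact he₀ (mem_zeroSet.1 he)
      simpa [h0] using he
  obtain ⟨X', q', h', f', s, hs, hq'⟩ := hc X
    (fun e => if e = e₀ then 1 else if q e = 0 then 0 else 2) (h.sum_eq hσ.1)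
  have hb' : ∀ e, 0 ≤ q' e ∧ q' e ≤ 3 := by simpa using h'.1
  obtain ⟨f, hf, hf0⟩ : ∃ f : V → ℤ, (∀ e, f (ends e).1 - f (ends e).2 =
      f' (ends e).1 - f' (ends e).2) ∧ f (ends e₀).2 = 0 :=
    ⟨fun v => f' v - f' (ends e₀).2, fun e => by ring, by ring⟩
  simp only [Pi.sub_apply, Nat.cast_ofNat, ← hf] at hq'
  have hr : ∀ r : ℤ, 0 ≤ r → r ≤ 2 → ∀ v w, (f v + r) / 4 = (f w + r) / 4 := by
    intro r hr0 hr2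
    refine eq_of_mem_univ hconn hσ (g := fun v => (f v + r) / 4)
      (h'.add_boundary_mem_univ hσ.2.1 (ε := fun e =>
        min 0 (s e + ((f (ends e).1 + r) / 4 - (f (ends e).2 + r) / 4))) fun e => ?_)
      (h.add_boundary_mem_univ hσ.2.1 (ε := fun e =>
        min 0 (-(s e + ((f (ends e).1 + r) / 4 - (f (ends e).2 + r) / 4)))) fun e => ?_) ?_
    · have h1 := hb' e
      have h2 := hq' e
      split_ifs at h2 <;> omega
    · have h1 := hb' e
      have h2 := hq' e
      split_ifs at h2 with h3 h4
      · subst h3; omega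
      · omega
      · omega
    · rw [eq_add_of_sub_eq hs, add_sub_add_comm, add_comm (boundary ends s), sub_add_cancel_left,
        ← sub_eq_neg_add, ← boundary_sub, ← boundary_sub, gradOn_univ]
      congr 1
      ext e
      simp only [Pi.sub_apply]
      omega
  have hf1 : ∀ v, f v = 0 ∨ f v = 1 := by
    intro v
    have h1 := hr 0 le_rfl (by norm_num) v (ends e₀).2
    have h2 := hr 2 (by norm_num) le_rfl v (ends e₀).2
    omega
  have hstar : ∀ e, let p := q e + (Pi.single e₀ 1 : E → ℤ) e - (f (ends e).1 - f (ends e).2)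
      - (m e + 1) * s e; (0 ≤ p ∧ p ≤ m e + 1) ∧ (q' e = 0 → p = 0) := by
    intro e p
    have h1 := hb' e
    have h2 := hq' e
    have h3 := h.1 e
    have h4 := hf1 (ends e).1
    have h5 := hf1 (ends e).2
    have hs' : s e = 0 ∨ s e = -1 := by
      split_ifs at h2 <;> omega
    simp only [p, Pi.single_apply]
    split_ifs at h2 ⊢ with h6 h7
    · subst h6
      rcases hs' with hs' | hs' <;> rw [hs'] at h2 ⊢ <;> omega
    · rcases hs' with hs' | hs' <;> rw [hs'] at h2 ⊢ <;> omega
    · rcases hs' with hs' | hs' <;> rw [hs'] at h2 ⊢ <;> omega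
  obtain ⟨X'', q'', h'', hrel⟩ := exists_isCode_of_le_add_one hσ.2.1 (m := m) h'.2
    (q := fun e => q e + (Pi.single e₀ 1 : E → ℤ) e - (f (ends e).1 - f (ends e).2)
      - (m e + 1) * s e) (fun e => (hstar e).1) (fun e he => (hstar e).2 (mem_zeroSet.1 he))
  refine ⟨X'', q'', h'', ?_⟩
  have h2 : SubdivRel ends m (X - X') fun e => f (ends e).1 - f (ends e).2 + (m e + 1) * s e :=
    ⟨f, s, hs, fun e => rfl⟩
  convert h2.add hrel using 1
  · abel
  · ext e; simp only [Pi.add_apply, Pi.sub_apply]; ring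

/-- If every lift can be moved by one step along each edge and these steps have finite order,
then the lifts represent all classes. -/
lemma exists_isCode_of_step (hconn : Conn ends univ) (hσ : IsStabilityAssignment ends d σ)
    {m : E → ℕ} (hfin : ∀ e, ∃ k : ℕ, 0 < k ∧ SubdivRel ends m 0 (k • Pi.single e 1))
    (hstep : ∀ {X : V → ℤ} {q : E → ℤ}, IsCode ends σ m X q → ∀ e, ∃ X' q',
      IsCode ends σ m X' q' ∧ SubdivRel ends m (X - X') (q + Pi.single e 1 - q'))
    {X : V → ℤ} (q : E → ℤ) (hX : ∑ v, X v = d) :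
    ∃ X' q', IsCode ends σ m X' q' ∧ SubdivRel ends m (X - X') (q - q') := by
  obtain ⟨X₀, hX₀⟩ : (σ univ).Nonempty := by
    obtain ⟨y, hy, -⟩ := (hσ.2.2 univ hconn).2 X (by simpa [Sdeg, nG] using hX)
    exact ⟨y, hy.1⟩
  have hz : zeroSet (0 : E → ℤ) = univ := by ext; simp
  have h₀ : IsCode ends σ m X₀ 0 := ⟨fun e => by simp, by simpa [hz, chipsOff_univ] using hX₀⟩
  let S : Set ((V → ℤ) × (E → ℤ)) := {p | ∃ X' q', IsCode ends σ m X' q' ∧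
    SubdivRel ends m (p.1 - X') (p.2 - q')}
  have hS : ∀ {Y p Y' p'}, (Y, p) ∈ S → SubdivRel ends m (Y' - Y) (p' - p) → (Y', p') ∈ S := by
    rintro Y p Y' p' ⟨Z, r, hZ, hrel⟩ h
    refine ⟨Z, r, hZ, ?_⟩
    convert h.add hrel using 1 <;> exact (sub_add_sub_cancel _ _ _).symm
  let T : AddSubmonoid (E → ℤ) :=
    { carrier := {t | ∀ Y p, (Y, p) ∈ S → (Y, p + t) ∈ S}
      zero_mem' := fun Y p h => by simpa using h
      add_mem' := fun {a b} ha hb Y p h => by rw [← add_assoc]; exact hb _ _ (ha _ _ h) }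
  have hTrel : ∀ t, SubdivRel ends m 0 t → t ∈ T := fun t ht Y p h =>
    hS h (by simpa using ht)
  have hT1 : ∀ e, Pi.single e 1 ∈ T := by
    rintro e Y p ⟨Z, r, hZ, hrel⟩
    obtain ⟨Z', r', hZ', hrel'⟩ := hstep hZ e
    refine ⟨Z', r', hZ', ?_⟩
    convert hrel.add hrel' using 1
    · simp
    · simp only; abel
  have hT2 : ∀ e, -Pi.single e 1 ∈ T := by
    intro e
    obtain ⟨k, hk, hrel⟩ := hfin e
    obtain ⟨k, rfl⟩ := Nat.exists_eq_add_one.2 hk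
    have h1 := hTrel (-((k + 1) • Pi.single e 1)) (by simpa only [neg_zero] using hrel.neg)
    have h2 := T.add_mem h1 (T.nsmul_mem (hT1 e) k)
    convert h2 using 1
    rw [add_smul, one_smul]; abel
  have hT : ∀ t, t ∈ T := by
    intro t
    have ht : t = ∑ e, ((t e).toNat • Pi.single e 1 + (-t e).toNat • -Pi.single e 1) := by
      ext e
      simp only [Finset.sum_apply, Pi.add_apply, Pi.smul_apply, Pi.neg_apply, Pi.single_apply]
      simp only [smul_neg, smul_ite, smul_zero, Finset.sum_add_distrib, Finset.sum_neg_distrib,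
        Finset.sum_ite_eq, mem_univ, if_true]
      simp
      omega
    rw [ht]
    exact T.sum_mem fun e _ => T.add_mem (T.nsmul_mem (hT1 e) _) (T.nsmul_mem (hT2 e) _)
  obtain ⟨s, hs⟩ := exists_boundary_eq hconn (x := X - X₀) (by
    simp only [Pi.sub_apply, Finset.sum_sub_distrib, hX, h₀.sum_eq hσ.1, sub_self])
  have h1 : (X₀, (0 : E → ℤ)) ∈ S := ⟨X₀, 0, h₀, 0, 0, by simp [boundary_zero], by simp⟩
  have h2 : (X, fun e => (m e + 1 : ℤ) * s e) ∈ S := hS h1 ⟨0, s, hs.symm, fun e => by simp⟩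
  have h3 := hT (q - fun e => (m e + 1 : ℤ) * s e) _ _ h2
  rwa [add_sub_cancel] at h3

end Completeness

section Counting

/-- The cokernel of a nonsingular integral matrix has order the absolute value of the
determinant. -/
lemma card_quotient_range_mulVecLin {n : Type*} [Fintype n] [DecidableEq n] {M : Matrix n n ℤ}
    (hM : M.det ≠ 0) : Nat.card ((n → ℤ) ⧸ LinearMap.range M.mulVecLin) = M.det.natAbs := by
  have hinj : Function.Injective M.mulVecLin := by
    rw [← LinearMap.ker_eq_bot, LinearMap.ker_eq_bot']
    intro v hv
    by_contra hne
    exact hM (Matrix.exists_mulVec_eq_zero_iff.1 ⟨v, hne, hv⟩)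
  rw [← Submodule.natAbs_det_equiv _ (LinearEquiv.ofInjective _ hinj)]
  congr 1
  rw [← LinearMap.det_toLin' M]
  congr 1

/-- Expansion of the determinant of a block matrix along the rows of a diagonal block. -/
lemma det_fromBlocks_diagonal_add_one {R : Type*} [CommRing R] (A : Matrix V V R)
    (B : Matrix V E R) (C : Matrix E V R) (m : E → ℕ) :
    (Matrix.fromBlocks A B C (Matrix.diagonal fun e => (m e : R) + 1)).det =
      ∑ q : ∀ e, Fin (m e + 1),
        (A - B * (Matrix.diagonal (fun e => if q e = 0 then (1 : R) else 0) * C)).det := by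
  let D : MultilinearMap R (fun _ : V ⊕ E => V ⊕ E → R) R :=
    (Matrix.detRowAlternating (R := R) (n := V ⊕ E)).toMultilinearMap
  have hD : ∀ M : Matrix (V ⊕ E) (V ⊕ E) R, M.det =
      D.currySum (fun v => M (Sum.inl v)) fun e => M (Sum.inr e) := by
    intro M
    rw [MultilinearMap.currySum_apply]
    change D M = D _
    congr 1
    ext i
    cases i <;> rfl
  rw [hD]
  have hrow : (fun e => Matrix.fromBlocks A B C (Matrix.diagonal fun e => (m e : R) + 1)
      (Sum.inr e)) = fun e => ∑ i : Fin (m e + 1),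
        Sum.elim (if i = 0 then C e else 0) (Pi.single e (1 : R)) := by
    ext e j
    rw [Finset.sum_apply]
    rcases j with v | e'
    · simp only [Matrix.fromBlocks_apply₂₁, Sum.elim_inl, ite_apply, Pi.zero_apply]
      rw [Finset.sum_ite_eq' univ (0 : Fin (m e + 1)) fun _ => C e v]
      simp
    · rcases eq_or_ne e e' with rfl | h
      · simp
      · simp [h, h.symm]
  rw [hrow, MultilinearMap.map_sum]
  refine Finset.sum_congr rfl fun q _ => ?_
  rw [← Matrix.det_fromBlocks_one₂₂, hD]
  congr 1
  ext e j
  rcases j with v | e'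
  · by_cases h : q e = 0 <;> simp [h, Matrix.diagonal_mul]
  · simp [Matrix.one_apply, Pi.single_apply, eq_comm]

variable (ends : E → V × V) (v₀ : V)

/-- The Laplacian of the spanning subgraph `A`, made nonsingular by adding one at `v₀`. -/
def groundedLap (A : Finset E) : Matrix V V ℤ :=
  Matrix.single v₀ v₀ 1 +
    incMatrix ends * (Matrix.diagonal (fun e => if e ∈ A then (1 : ℤ) else 0) *
      (incMatrix ends).transpose)

lemma transpose_incMatrix_mulVec (f : V → ℤ) (e : E) :
    ((incMatrix ends).transpose.mulVec f) e = f (ends e).2 - f (ends e).1 := by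
  simp only [Matrix.mulVec, dotProduct, Matrix.transpose_apply, incMatrix, Matrix.of_apply,
    mul_comm _ (f _), mul_sub, Finset.sum_sub_distrib, sum_mul_stdVec]

lemma single_mulVec_eq (f : V → ℤ) :
    (Matrix.single v₀ v₀ (1 : ℤ)).mulVec f = f v₀ • stdVec v₀ := by
  ext v
  simp [Matrix.single_mulVec, stdVec, Function.update_apply]

lemma groundedLap_mulVec (A : Finset E) (f : V → ℤ) :
    (groundedLap ends v₀ A).mulVec f = f v₀ • stdVec v₀ - boundary ends (gradOn ends A f) := by
  rw [groundedLap, Matrix.add_mulVec, single_mulVec_eq, ← Matrix.mulVec_mulVec,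
    ← Matrix.mulVec_mulVec, sub_eq_add_neg, boundary, ← Matrix.mulVec_neg]
  congr 2
  ext e
  rw [Matrix.mulVec_diagonal, transpose_incMatrix_mulVec, Pi.neg_apply, gradOn]
  split_ifs <;> ring

lemma sum_smul_stdVec (c : ℤ) (v : V) : ∑ w, (c • stdVec v) w = c := by
  simp [stdVec]

lemma mem_range_groundedLap {A : Finset E} {x : V → ℤ} :
    x ∈ LinearMap.range (groundedLap ends v₀ A).mulVecLin ↔
      x - (∑ v, x v) • stdVec v₀ ∈ twGroup ends A := by
  rw [mem_twGroup_iff, LinearMap.mem_range]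
  simp only [Matrix.mulVecLin_apply, groundedLap_mulVec]
  constructor
  · rintro ⟨f, rfl⟩
    refine ⟨-f, ?_⟩
    simp only [Pi.sub_apply, Finset.sum_sub_distrib, sum_smul_stdVec, sum_boundary, sub_zero]
    rw [sub_sub_cancel_left, boundary, boundary, ← Matrix.mulVec_neg]
    congr 1
    ext e; simp only [gradOn, Pi.neg_apply]; split_ifs <;> ring
  · rintro ⟨g, hg⟩
    refine ⟨fun v => ∑ v, x v + g v₀ - g v, ?_⟩
    have hneg : boundary ends (gradOn ends A fun v => ∑ v, x v + g v₀ - g v) =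
        -boundary ends (gradOn ends A g) := by
      rw [boundary, boundary, ← Matrix.mulVec_neg]
      congr 1
      ext e; simp only [gradOn, Pi.neg_apply]; split_ifs <;> ring
    rw [hneg, ← hg]
    simp only [add_sub_cancel_right, neg_sub, sub_sub_cancel]

lemma groundedLap_det_nonneg (A : Finset E) : 0 ≤ (groundedLap ends v₀ A).det := by
  have hfac : groundedLap ends v₀ A =
      Matrix.fromCols (Matrix.single v₀ v₀ 1)
        (incMatrix ends * Matrix.diagonal (fun e => if e ∈ A then (1 : ℤ) else 0)) *
      (Matrix.fromCols (Matrix.single v₀ v₀ 1)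
        (incMatrix ends * Matrix.diagonal (fun e => if e ∈ A then (1 : ℤ) else 0))).transpose := by
    rw [Matrix.transpose_fromCols, Matrix.fromCols_mul_fromRows, groundedLap, Matrix.transpose_mul,
      Matrix.diagonal_transpose, Matrix.transpose_single, Matrix.single_mul_single_same,
      Matrix.mul_assoc, ← Matrix.mul_assoc (Matrix.diagonal _) (Matrix.diagonal _),
      Matrix.diagonal_mul_diagonal, mul_one]
    simp only [mul_ite, mul_one, mul_zero, ← ite_and, and_self]
  have h := (Matrix.posSemidef_self_mul_conjTranspose
    ((Matrix.fromCols (Matrix.single v₀ v₀ 1)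
        (incMatrix ends * Matrix.diagonal (fun e => if e ∈ A then (1 : ℤ) else 0))).map
          (Int.castRingHom ℝ))).det_nonneg
  rw [Matrix.conjTranspose_eq_transpose_of_trivial, ← Matrix.transpose_map, ← Matrix.map_mul,
    ← hfac, ← RingHom.mapMatrix_apply, ← RingHom.map_det, eq_intCast] at h
  exact_mod_cast h

lemma groundedLap_det_eq_zero {A : Finset E} (hA : ¬Conn ends A) :
    (groundedLap ends v₀ A).det = 0 := by
  classical
  obtain ⟨v, w, hvw⟩ : ∃ v w, ¬Linked ends A v w := by
    by_contra! h
    exact hA ⟨⟨v₀⟩, h⟩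
  have hedge : ∀ e ∈ A, Linked ends A v (ends e).1 ↔ Linked ends A v (ends e).2 := fun e he =>
    ⟨fun h => h.tail ⟨e, he, rfl⟩, fun h => h.tail ⟨e, he, Sym2.eq_swap⟩⟩
  let g : V → ℤ := fun u => if Linked ends A v u then 1 else 0
  refine Matrix.exists_mulVec_eq_zero_iff.1 ⟨fun u => g u - g v₀, fun h => ?_, ?_⟩
  · have h1 := congrFun h v
    have h2 := congrFun h w
    have h3 : g v = 1 := if_pos Relation.ReflTransGen.refl
    have h4 : g w = 0 := if_neg hvw
    simp only [Pi.zero_apply] at h1 h2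
    omega
  · have h0 : gradOn ends A (fun u => g u - g v₀) = 0 := by
      ext e
      simp only [gradOn, g]
      split_ifs with he <;> simp_all
    rw [groundedLap_mulVec, h0, boundary_zero]
    simp

lemma groundedLap_det_ne_zero {A : Finset E} (hA : Conn ends A) :
    (groundedLap ends v₀ A).det ≠ 0 := by
  intro h
  obtain ⟨f, hf, h0⟩ := Matrix.exists_mulVec_eq_zero_iff.2 h
  rw [groundedLap_mulVec] at h0
  have h1 : f v₀ = 0 := by
    have := congrArg (fun x : V → ℤ => ∑ v, x v) h0
    simpa [Finset.sum_sub_distrib, sum_boundary, stdVec] using this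
  rw [h1, zero_smul, zero_sub, neg_eq_zero] at h0
  exact hf (funext fun v => (eq_of_boundary_gradOn_eq_zero hA h0 v v₀).trans h1)

variable {ends}

lemma card_eq_groundedLap_det {d : ℤ} {A : Finset E} (hA : Conn ends A) {S : Set (V → ℤ)}
    (hS : IsRepSet ends d A S) : Finite S ∧ (Nat.card S : ℤ) = (groundedLap ends v₀ A).det := by
  have hcard := card_quotient_range_mulVecLin (groundedLap_det_ne_zero ends v₀ hA)
  have hbij : Function.Bijective fun x : S =>
      (LinearMap.range (groundedLap ends v₀ A).mulVecLin).mkQ x := by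
    constructor
    · intro x y hxy
      have h1 := (Submodule.Quotient.eq _).1 hxy
      rw [mem_range_groundedLap] at h1
      have hx : ∑ v, x.1 v = d - nG A := hS.1 x.2
      have hy : ∑ v, y.1 v = d - nG A := hS.1 y.2
      simp only [Pi.sub_apply, Finset.sum_sub_distrib, hx, hy, sub_self, zero_smul, sub_zero] at h1
      exact Subtype.ext ((hS.2 _ (hS.1 x.2)).unique ⟨x.2, by simp⟩ ⟨y.2, h1⟩)
    · intro z
      obtain ⟨z, rfl⟩ := Submodule.mkQ_surjective _ z
      obtain ⟨y, ⟨hy, hzy⟩, -⟩ := hS.2 (z + (d - nG A - ∑ v, z v) • stdVec v₀) (by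
        simp [Sdeg, Finset.sum_add_distrib, stdVec])
      refine ⟨⟨y, hy⟩, ((Submodule.Quotient.eq _).2 ?_).symm⟩
      rw [mem_range_groundedLap]
      have hs : ∑ v, y v = d - nG A := hS.1 hy
      convert hzy using 1
      simp only [Pi.sub_apply, Finset.sum_sub_distrib, hs, sub_smul]
      abel
  have h1 := Nat.card_congr (Equiv.ofBijective _ hbij)
  rw [hcard] at h1
  have h2 := groundedLap_det_ne_zero ends v₀ hA
  refine ⟨Nat.finite_of_card_ne_zero (by omega), ?_⟩
  have h3 := groundedLap_det_nonneg ends v₀ A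
  omega

variable (ends)

/-- The matrix presenting the lattice of relations `SubdivRel`, made nonsingular by adding one
at `v₀`. -/
def subdivMatrix (m : E → ℕ) : Matrix (V ⊕ E) (V ⊕ E) ℤ :=
  Matrix.fromBlocks (Matrix.single v₀ v₀ 1) (incMatrix ends) (-(incMatrix ends).transpose)
    (Matrix.diagonal fun e => (m e : ℤ) + 1)

lemma subdivMatrix_mulVec (m : E → ℕ) (p : V ⊕ E → ℤ) :
    (subdivMatrix ends v₀ m).mulVec p =
      Sum.elim (p (Sum.inl v₀) • stdVec v₀ + boundary ends (p ∘ Sum.inr)) fun e =>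
        p (Sum.inl (ends e).1) - p (Sum.inl (ends e).2) + (m e + 1) * p (Sum.inr e) := by
  rw [subdivMatrix, Matrix.fromBlocks_mulVec, single_mulVec_eq]
  congr 1
  ext e
  rw [Pi.add_apply, Matrix.mulVec_diagonal, Matrix.neg_mulVec, Pi.neg_apply,
    transpose_incMatrix_mulVec]
  simp only [Function.comp_apply, neg_sub]

lemma mem_range_subdivMatrix {m : E → ℕ} {X : V → ℤ} {q : E → ℤ} :
    Sum.elim X q ∈ LinearMap.range (subdivMatrix ends v₀ m).mulVecLin ↔
      SubdivRel ends m (X - (∑ v, X v) • stdVec v₀) q := by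
  simp only [LinearMap.mem_range, Matrix.mulVecLin_apply, subdivMatrix_mulVec, Sum.elim_eq_iff]
  constructor
  · rintro ⟨p, rfl, rfl⟩
    refine ⟨p ∘ Sum.inl, p ∘ Sum.inr, ?_, fun e => rfl⟩
    simp only [Pi.add_apply, Finset.sum_add_distrib, sum_smul_stdVec, sum_boundary, add_zero]
    exact add_sub_cancel_left _ _
  · rintro ⟨f, s, hs, hq⟩
    refine ⟨Sum.elim (fun v => f v - f v₀ + ∑ v, X v) s, ?_, funext fun e => ?_⟩
    · simp only [Sum.elim_inl, Sum.elim_comp_inr, ← hs, sub_self, zero_add]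
      exact add_sub_cancel _ _
    · simp only [Sum.elim_inl, Sum.elim_inr, hq e]; ring

variable {ends} {d : ℤ} {σ : Finset E → Set (V → ℤ)}

lemma subdivMatrix_det (m : E → ℕ) : (subdivMatrix ends v₀ m).det =
    ∑ q : ∀ e, Fin (m e + 1), (groundedLap ends v₀ (univ.filter fun e => q e = 0)).det := by
  rw [subdivMatrix, det_fromBlocks_diagonal_add_one]
  refine Finset.sum_congr rfl fun q _ => ?_
  simp [groundedLap]

lemma subdivMatrix_det_pos (hconn : Conn ends univ) (m : E → ℕ) :
    0 < (subdivMatrix ends v₀ m).det := by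
  rw [subdivMatrix_det]
  refine Finset.sum_pos' (fun q _ => groundedLap_det_nonneg ends v₀ _) ⟨0, mem_univ _, ?_⟩
  refine (groundedLap_det_nonneg ends v₀ _).lt_of_ne' (groundedLap_det_ne_zero ends v₀ ?_)
  simpa using hconn

lemma zeroSet_coe_fin {m : E → ℕ} (q : ∀ e, Fin (m e + 1)) :
    zeroSet (fun e => (q e : ℤ)) = univ.filter fun e => q e = 0 := by
  ext e
  simp only [mem_zeroSet, mem_filter, mem_univ, true_and, Fin.ext_iff, Fin.val_zero,
    Nat.cast_eq_zero]

/-- The codes of lifts are parametrized by the disjoint union of the sets `σ A`. -/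
def codeOfSigma (m : E → ℕ) (y : Σ q : ∀ e, Fin (m e + 1), σ (univ.filter fun e => q e = 0)) :
    {p : (V → ℤ) × (E → ℤ) // IsCode ends σ m p.1 p.2} :=
  ⟨(y.2 + chipsOff ends (univ.filter fun e => y.1 e = 0), fun e => (y.1 e : ℤ)),
    fun e => by have := (y.1 e).2; dsimp only; omega, by
      simp only [zeroSet_coe_fin, add_sub_cancel_right]
      exact y.2.2⟩

lemma codeOfSigma_bijective (m : E → ℕ) :
    Function.Bijective (codeOfSigma (ends := ends) (σ := σ) m) := by
  constructor
  · rintro ⟨q, x⟩ ⟨q', x'⟩ h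
    obtain ⟨h1, h2⟩ := Prod.ext_iff.1 (Subtype.ext_iff.1 h)
    obtain rfl : q = q' := by
      ext e
      exact Int.ofNat_inj.1 (congrFun h2 e)
    have h3 : (x : V → ℤ) = x' := add_right_cancel h1
    rw [Subtype.ext h3]
  · rintro ⟨⟨X, q⟩, hq, hX⟩
    let r : ∀ e, Fin (m e + 1) := fun e => ⟨(q e).toNat, by have := hq e; dsimp only at this; omega⟩
    have hr : (fun e => (r e : ℤ)) = q := funext fun e => Int.toNat_of_nonneg (hq e).1
    have hz : zeroSet q = univ.filter fun e => r e = 0 := by rw [← zeroSet_coe_fin, hr]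
    refine ⟨⟨r, X - chipsOff ends (univ.filter fun e => r e = 0), ?_⟩, ?_⟩
    · rw [← hz]; exact hX
    · exact Subtype.ext (Prod.ext (sub_add_cancel _ _) hr)

lemma card_codes (hσ : IsStabilityAssignment ends d σ) (m : E → ℕ) :
    Finite {p : (V → ℤ) × (E → ℤ) // IsCode ends σ m p.1 p.2} ∧
      Nat.card {p : (V → ℤ) × (E → ℤ) // IsCode ends σ m p.1 p.2} =
        (subdivMatrix ends v₀ m).det := by
  have h : ∀ A, Finite (σ A) ∧ (Nat.card (σ A) : ℤ) = (groundedLap ends v₀ A).det := by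
    intro A
    by_cases hA : Conn ends A
    · exact card_eq_groundedLap_det v₀ hA (hσ.2.2 A hA)
    · have he : σ A = ∅ := Set.eq_empty_of_forall_notMem fun x hx => hA (hσ.1 A x hx).1
      rw [he, groundedLap_det_eq_zero ends v₀ hA]
      exact ⟨inferInstance, by simp⟩
  have := fun A => (h A).1
  have hb := codeOfSigma_bijective (ends := ends) (σ := σ) m
  refine ⟨Finite.of_surjective _ hb.2, ?_⟩
  rw [← Nat.card_congr (Equiv.ofBijective _ hb), Nat.card_sigma, subdivMatrix_det, Nat.cast_sum]
  exact Finset.sum_congr rfl fun q _ => (h _).2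

/-- The class of a pair `(X, q)` modulo the relations. -/
def codeClass (m : E → ℕ) (p : {p : (V → ℤ) × (E → ℤ) // IsCode ends σ m p.1 p.2}) :
    (V ⊕ E → ℤ) ⧸ LinearMap.range (subdivMatrix ends v₀ m).mulVecLin :=
  Submodule.Quotient.mk (Sum.elim p.1.1 p.1.2)

lemma subdivMatrix_quotient (hconn : Conn ends univ) (m : E → ℕ) :
    Finite ((V ⊕ E → ℤ) ⧸ LinearMap.range (subdivMatrix ends v₀ m).mulVecLin) ∧
      Nat.card ((V ⊕ E → ℤ) ⧸ LinearMap.range (subdivMatrix ends v₀ m).mulVecLin) =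
        (subdivMatrix ends v₀ m).det := by
  have h := subdivMatrix_det_pos v₀ hconn m
  have h1 := card_quotient_range_mulVecLin h.ne'
  exact ⟨Nat.finite_of_card_ne_zero (by omega), by omega⟩

lemma codeClass_injective_iff (hσ : IsAssignment ends d σ) {m : E → ℕ} :
    Function.Injective (codeClass (ends := ends) (σ := σ) v₀ m) ↔ ∀ {X X' q q'},
      IsCode ends σ m X q → IsCode ends σ m X' q' → SubdivRel ends m (X - X') (q - q') →
        X = X' ∧ q = q' := by
  have key : ∀ p p', codeClass (ends := ends) (σ := σ) v₀ m p =
      codeClass (ends := ends) (σ := σ) v₀ m p' ↔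
      SubdivRel ends m (p.1.1 - p'.1.1) (p.1.2 - p'.1.2) := by
    intro p p'
    have h : Sum.elim p.1.1 p.1.2 - Sum.elim p'.1.1 p'.1.2 =
        Sum.elim (p.1.1 - p'.1.1) (p.1.2 - p'.1.2) := by
      ext i; cases i <;> rfl
    rw [codeClass, codeClass, Submodule.Quotient.eq, h, mem_range_subdivMatrix]
    simp [Finset.sum_sub_distrib, p.2.sum_eq hσ, p'.2.sum_eq hσ]
  constructor
  · intro h X X' q q' hX hX' hrel
    have := @h ⟨(X, q), hX⟩ ⟨(X', q'), hX'⟩ ((key _ _).2 hrel)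
    simpa using this
  · intro h p p' hpp
    obtain ⟨h1, h2⟩ := h p.2 p'.2 ((key _ _).1 hpp)
    exact Subtype.ext (Prod.ext h1 h2)

lemma codeClass_surjective_iff (hσ : IsAssignment ends d σ) {m : E → ℕ} :
    Function.Surjective (codeClass (ends := ends) (σ := σ) v₀ m) ↔ ∀ X q, ∑ v, X v = d →
      ∃ X' q', IsCode ends σ m X' q' ∧ SubdivRel ends m (X - X') (q - q') := by
  have key : ∀ X q p, Submodule.Quotient.mk (Sum.elim X q) = codeClass (ends := ends) (σ := σ)
      v₀ m p ↔ SubdivRel ends m (X + (d - ∑ v, X v) • stdVec v₀ - p.1.1) (q - p.1.2) := by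
    intro X q p
    have h : Sum.elim X q - Sum.elim p.1.1 p.1.2 = Sum.elim (X - p.1.1) (q - p.1.2) := by
      ext i; cases i <;> rfl
    rw [codeClass, Submodule.Quotient.eq, h, mem_range_subdivMatrix]
    simp only [Pi.sub_apply, Finset.sum_sub_distrib, p.2.sum_eq hσ, sub_smul]
    rw [show X + (d • stdVec v₀ - (∑ v, X v) • stdVec v₀) - p.1.1 =
      X - p.1.1 - ((∑ v, X v) • stdVec v₀ - d • stdVec v₀) by abel]
  constructor
  · intro h X q hX
    obtain ⟨p, hp⟩ := h (Submodule.Quotient.mk (Sum.elim X q))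
    have := (key X q p).1 hp.symm
    rw [hX, sub_self, zero_smul, add_zero] at this
    exact ⟨_, _, p.2, this⟩
  · intro h z
    obtain ⟨z, rfl⟩ := Submodule.mkQ_surjective _ z
    obtain ⟨X', q', h', hrel⟩ := h
      (z ∘ Sum.inl + (d - ∑ v, (z ∘ Sum.inl) v) • stdVec v₀) (z ∘ Sum.inr) (by
        simp [Finset.sum_add_distrib, stdVec])
    refine ⟨⟨(X', q'), h'⟩, ((key (z ∘ Sum.inl) (z ∘ Sum.inr) ⟨(X', q'), h'⟩).2 hrel).symm.trans ?_⟩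
    rw [Sum.elim_comp_inl_inr, Submodule.mkQ_apply]

/-- The lifts represent all classes of total degree `d`. -/
lemma exists_isCode (hconn : Conn ends univ) (hσ : IsStabilityAssignment ends d σ) (m : E → ℕ)
    {X : V → ℤ} (q : E → ℤ) (hX : ∑ v, X v = d) :
    ∃ X' q', IsCode ends σ m X' q' ∧ SubdivRel ends m (X - X') (q - q') := by
  obtain ⟨⟨v₀⟩, -⟩ := id hconn
  have hc : Function.Surjective (codeClass (ends := ends) (σ := σ) v₀ fun _ => 3) := by
    have h1 := (codeClass_injective_iff (ends := ends) v₀ hσ.1 (m := fun _ => 3)).2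
      fun h h' hrel => h.eq_of_rel hconn hσ h' hrel
    obtain ⟨hfin, hcard⟩ := subdivMatrix_quotient v₀ hconn fun _ => 3
    refine (h1.bijective_of_nat_card_le ?_).2
    have := (card_codes v₀ hσ fun _ => 3).2
    omega
  refine exists_isCode_of_step hconn hσ (fun e => ?_) (fun h e => h.exists_step hconn hσ
    ((codeClass_surjective_iff v₀ hσ.1).1 hc) e) q hX
  obtain ⟨hfin, -⟩ := subdivMatrix_quotient v₀ hconn m
  obtain ⟨k, hk, h⟩ := isOfFinAddOrder_iff_nsmul_eq_zero.1 (isOfFinAddOrder_of_finite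
    (Submodule.Quotient.mk (p := LinearMap.range (subdivMatrix ends v₀ m).mulVecLin)
      (Sum.elim 0 (Pi.single e 1))))
  refine ⟨k, hk, ?_⟩
  rw [← Submodule.Quotient.mk_smul, Submodule.Quotient.mk_eq_zero] at h
  have h2 : k • (Sum.elim 0 (Pi.single e 1) : V ⊕ E → ℤ) =
      Sum.elim (0 : V → ℤ) (k • Pi.single e 1 : E → ℤ) := by
    ext i
    cases i
    · simp only [Pi.smul_apply, Sum.elim_inl, Pi.zero_apply, smul_zero]
    · rfl
  rw [h2, mem_range_subdivMatrix] at h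
  simpa using h

/-- Different lifts are inequivalent. -/
lemma IsCode.eq_of_subdivRel (hconn : Conn ends univ) (hσ : IsStabilityAssignment ends d σ)
    {m : E → ℕ} {X X' : V → ℤ} {q q' : E → ℤ} (h : IsCode ends σ m X q)
    (h' : IsCode ends σ m X' q') (hrel : SubdivRel ends m (X - X') (q - q')) :
    X = X' ∧ q = q' := by
  obtain ⟨⟨v₀⟩, -⟩ := id hconn
  refine (codeClass_injective_iff v₀ hσ.1).1 ?_ h h' hrel
  have h1 := (codeClass_surjective_iff v₀ hσ.1).2 fun X q hX => exists_isCode hconn hσ m q hX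
  obtain ⟨hfin, hcard⟩ := card_codes v₀ hσ m
  refine (h1.bijective_of_nat_card_le ?_).1
  have := (subdivMatrix_quotient v₀ hconn m).2
  omega

end Counting

section Subdivision

variable (ends : E → V × V) (m : E → ℕ)

lemma subNode_zero (e : E) : subNode ends m e 0 = Sum.inl (ends e).1 := rfl

lemma subNode_succ_of_lt {e : E} {i : ℕ} (h : i < m e) :
    subNode ends m e (i + 1) = Sum.inr ⟨e, ⟨i, h⟩⟩ := by
  simp [subNode, Nat.succ_le_iff.2 h]

lemma subNode_last (e : E) : subNode ends m e (m e + 1) = Sum.inl (ends e).2 := by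
  simp [subNode]

/-- The multidegree on `Γ` obtained by moving the chips on each exceptional vertex to the second
endpoint of the edge containing it. -/
def pushX (D : SubV V E m → ℤ) (v : V) : ℤ :=
  ∑ w, Sum.elim (fun w => if w = v then (1 : ℤ) else 0)
    (fun p : Σ e : E, Fin (m e) => if (ends p.1).2 = v then 1 else 0) w * D w

/-- The total distance of the chips on the chain replacing `e` to the second endpoint. -/
def pushQ (D : SubV V E m → ℤ) (e : E) : ℤ :=
  ∑ w, Sum.elim (fun _ => (0 : ℤ))
    (fun p : Σ e : E, Fin (m e) => if p.1 = e then (m e : ℤ) - (p.2 : ℕ) else 0) w * D w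

lemma pushX_sub (D D' : SubV V E m → ℤ) :
    pushX ends m (D - D') = pushX ends m D - pushX ends m D' := by
  ext v
  simp only [pushX, Pi.sub_apply, mul_sub, Finset.sum_sub_distrib]

lemma pushQ_sub (D D' : SubV V E m → ℤ) : pushQ m (D - D') = pushQ m D - pushQ m D' := by
  ext e
  simp only [pushQ, Pi.sub_apply, mul_sub, Finset.sum_sub_distrib]

lemma pushX_apply (D : SubV V E m → ℤ) (v : V) : pushX ends m D v =
    D (Sum.inl v) + ∑ e, ∑ i, if (ends e).2 = v then D (Sum.inr ⟨e, i⟩) else 0 := by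
  simp only [pushX, Fintype.sum_sum_type, Fintype.sum_sigma, Sum.elim_inl, Sum.elim_inr, ite_mul,
    one_mul, zero_mul, Finset.sum_ite_eq', mem_univ, if_true]

lemma pushQ_apply (D : SubV V E m → ℤ) (e : E) : pushQ m D e =
    ∑ i : Fin (m e), ((m e : ℤ) - (i : ℕ)) * D (Sum.inr ⟨e, i⟩) := by
  simp only [pushQ, Fintype.sum_sum_type, Fintype.sum_sigma, Sum.elim_inl, Sum.elim_inr, zero_mul,
    Finset.sum_const_zero, zero_add]
  rw [Finset.sum_eq_single e]
  · simp
  · intro e' _ h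
    simp [h]
  · simp

lemma sum_pushX (D : SubV V E m → ℤ) : ∑ v, pushX ends m D v = ∑ w, D w := by
  simp only [pushX]
  rw [Finset.sum_comm]
  simp only [← Finset.sum_mul]
  refine Finset.sum_congr rfl fun w _ => ?_
  cases w <;> simp

lemma sum_mul_boundary_subEnds (G : SubV V E m → ℤ) (S : SubE E m → ℤ) :
    ∑ w, G w * boundary (subEnds ends m) S w = ∑ e, (S ⟨e, 0⟩ *
      (G (subNode ends m e 1) - G (Sum.inl (ends e).1)) + ∑ j : Fin (m e), S ⟨e, j.succ⟩ *
        (G (subNode ends m e (j + 1 + 1)) - G (subNode ends m e (j + 1)))) := by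
  rw [sum_mul_boundary, Fintype.sum_sigma]
  refine Finset.sum_congr rfl fun e _ => ?_
  rw [Fin.sum_univ_succ]
  rfl

lemma pushX_boundary (S : SubE E m → ℤ) :
    pushX ends m (boundary (subEnds ends m) S) = boundary ends fun e => S ⟨e, 0⟩ := by
  ext v
  have hG : ∀ e j, j ≤ m e → Sum.elim (fun w => if w = v then (1 : ℤ) else 0)
      (fun p : Σ e : E, Fin (m e) => if (ends p.1).2 = v then 1 else 0)
      (subNode ends m e (j + 1)) = if (ends e).2 = v then 1 else 0 := by
    intro e j hj
    rcases hj.lt_or_eq with h | rfl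
    · rw [subNode_succ_of_lt ends m h, Sum.elim_inr]
    · rw [subNode_last, Sum.elim_inl]
  rw [pushX, sum_mul_boundary_subEnds, boundary_apply]
  refine Finset.sum_congr rfl fun e _ => ?_
  rw [Finset.sum_eq_zero fun j _ => ?_, add_zero, hG e 0 (Nat.zero_le _), Sum.elim_inl, mul_comm]
  · simp only [stdVec, eq_comm]
  · rw [hG e _ j.2, hG e _ j.2.le, sub_self, mul_zero]

lemma pushQ_boundary (S : SubE E m → ℤ) (e : E) :
    pushQ m (boundary (subEnds ends m) S) e =
      (m e + 1) * S ⟨e, 0⟩ - ∑ j : Fin (m e + 1), S ⟨e, j⟩ := by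
  have hG : ∀ e' j, j ≤ m e' → Sum.elim (fun _ => (0 : ℤ))
      (fun p : Σ e : E, Fin (m e) => if p.1 = e then (m e : ℤ) - (p.2 : ℕ) else 0)
      (subNode ends m e' (j + 1)) = if e' = e then (m e : ℤ) - j else 0 := by
    intro e' j hj
    rcases hj.lt_or_eq with h | rfl
    · rw [subNode_succ_of_lt ends m h, Sum.elim_inr]
    · rw [subNode_last, Sum.elim_inl]
      split_ifs with h
      · rw [h, sub_self]
      · rfl
  rw [pushQ, sum_mul_boundary_subEnds, Finset.sum_eq_single e]
  · rw [hG e 0 (Nat.zero_le _), Sum.elim_inl, if_pos rfl, Fin.sum_univ_succ,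
      Finset.sum_congr rfl fun j _ => ?_]
    rotate_left
    · intro j
      exact -S ⟨e, j.succ⟩
    · rw [hG e _ j.2, hG e _ j.2.le, if_pos rfl, if_pos rfl]
      push_cast
      ring
    · rw [Finset.sum_neg_distrib]
      push_cast
      ring
  · intro e' _ h
    rw [hG e' 0 (Nat.zero_le _), if_neg h, Finset.sum_eq_zero fun j _ => ?_]
    · simp
    · rw [hG e' _ j.2, hG e' _ j.2.le, if_neg h, if_neg h, sub_self, mul_zero]
  · simp

lemma boundary_subEnds_inr (S : SubE E m → ℤ) (e : E) (i : Fin (m e)) :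
    boundary (subEnds ends m) S (Sum.inr ⟨e, i⟩) = S ⟨e, i.castSucc⟩ - S ⟨e, i.succ⟩ := by
  let G : SubV V E m → ℤ :=
    Sum.elim (fun _ => 0) fun p => if p.1 = e ∧ (p.2 : ℕ) = i then 1 else 0
  have hG : ∀ e' j, j ≤ m e' →
      G (subNode ends m e' (j + 1)) = if e' = e ∧ j = i then 1 else 0 := by
    intro e' j hj
    rcases hj.lt_or_eq with h | rfl
    · rw [subNode_succ_of_lt ends m h]; rfl
    · rw [subNode_last, if_neg]
      · rfl
      · rintro ⟨rfl, h⟩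
        exact i.2.ne' h
  have hw : ∑ w, G w * boundary (subEnds ends m) S w =
      boundary (subEnds ends m) S (Sum.inr ⟨e, i⟩) := by
    rw [Finset.sum_eq_single (Sum.inr ⟨e, i⟩)]
    · simp [G]
    · rintro (v | ⟨e', j⟩) _ h
      · simp [G]
      · rw [show G (Sum.inr ⟨e', j⟩) = 0 from if_neg ?_, zero_mul]
        rintro ⟨rfl, hj⟩
        exact h (congrArg Sum.inr (congrArg (Sigma.mk e') (Fin.ext hj)))
    · simp
  rw [← hw, sum_mul_boundary_subEnds, Finset.sum_eq_single e]
  · have h1 : ∀ j : Fin (m e), G (subNode ends m e (j + 1 + 1)) - G (subNode ends m e (j + 1)) =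
        (if j.succ = i.castSucc then 1 else 0) - if j = i then 1 else 0 := by
      intro j
      rw [hG e _ j.2, hG e _ j.2.le]
      simp [Fin.ext_iff]
    have h2 : G (subNode ends m e 1) - G (Sum.inl (ends e).1) =
        if (0 : Fin (m e + 1)) = i.castSucc then 1 else 0 := by
      rw [hG e 0 (Nat.zero_le _)]
      simp [G, Fin.ext_iff]
    simp only [h1, h2, mul_sub, Finset.sum_sub_distrib]
    rw [← add_sub_assoc,
      ← Fin.sum_univ_succ fun j => S ⟨e, j⟩ * if j = i.castSucc then (1 : ℤ) else 0]
    simp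
  · intro e' _ h
    rw [hG e' 0 (Nat.zero_le _), if_neg (fun h' => h h'.1), Finset.sum_eq_zero fun j _ => ?_]
    · simp [G]
    · rw [hG e' _ j.2, hG e' _ j.2.le, if_neg fun h' => h h'.1, if_neg fun h' => h h'.1, sub_self,
        mul_zero]
  · simp

/-- A chip configuration on `Γ̃_m` is principal if and only if the associated
pair is a relation. -/
lemma mem_twGroup_subEnds_iff {D : SubV V E m → ℤ} :
    D ∈ twGroup (subEnds ends m) univ ↔ SubdivRel ends m (pushX ends m D) (pushQ m D) := by
  rw [mem_twGroup_iff]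
  constructor
  · rintro ⟨f, rfl⟩
    refine ⟨fun v => -f (Sum.inl v), _, pushX_boundary ends m _, fun e => ?_⟩
    rw [pushQ_boundary, gradOn_univ]
    have := Fin.sum_univ_eq_sum_range (fun j => f (subNode ends m e j) - f (subNode ends m e (j + 1)))
      (m e + 1)
    rw [Finset.sum_range_sub', subNode_zero, subNode_last] at this
    simp only [subEnds] at this ⊢
    rw [this]
    ring
  · rintro ⟨f, s, hs, hq⟩
    let T : E → ℕ → ℤ := fun e j =>
      s e - ∑ i ∈ range j, if h : i < m e then D (Sum.inr ⟨e, ⟨i, h⟩⟩) else 0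
    let S : SubE E m → ℤ := fun p => T p.1 p.2
    have hS0 : ∀ e, S ⟨e, 0⟩ = s e := fun e => by simp [S, T]
    have hD : boundary (subEnds ends m) S = D := by
      have hinr : ∀ e i, boundary (subEnds ends m) S (Sum.inr ⟨e, i⟩) = D (Sum.inr ⟨e, i⟩) := by
        intro e i
        rw [boundary_subEnds_inr]
        simp [S, T, Finset.sum_range_succ]
      have hX : pushX ends m (boundary (subEnds ends m) S) = pushX ends m D := by
        rw [pushX_boundary, hs]
        simp only [hS0]
      funext w
      rcases w with v | ⟨e, i⟩
      · have := congrFun hX v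
        simp only [pushX_apply, hinr] at this
        exact add_right_cancel this
      · exact hinr e i
    have hsum : ∀ e, ∑ j ∈ range (m e + 1), T e j = f (ends e).2 - f (ends e).1 := by
      intro e
      have h1 := hq e
      rw [← hD, pushQ_boundary, hS0] at h1
      rw [← Fin.sum_univ_eq_sum_range]
      change ∑ j : Fin (m e + 1), S ⟨e, j⟩ = _
      linarith
    let F : SubV V E m → ℤ := Sum.elim (fun v => -f v)
      fun p => -f (ends p.1).1 - ∑ j ∈ range (p.2 + 1), T p.1 j
    have hF : ∀ e j, j ≤ m e + 1 →
        F (subNode ends m e j) = -f (ends e).1 - ∑ j ∈ range j, T e j := by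
      intro e j hj
      rcases j with _ | j
      · simp [subNode_zero, F]
      · rcases (Nat.le_of_succ_le_succ hj).lt_or_eq with h | rfl
        · rw [subNode_succ_of_lt ends m h]; rfl
        · rw [subNode_last, hsum]
          simp only [F, Sum.elim_inl]
          ring
    refine ⟨F, ?_⟩
    rw [← hD, gradOn_univ]
    congr 1
    funext ⟨e, j⟩
    simp only [subEnds]
    rw [hF e _ j.2.le, hF e _ j.2, Finset.sum_range_succ]
    simp only [S]
    ring

end Subdivision

section Lift

variable {ends : E → V × V} {d : ℤ} {σ : Finset E → Set (V → ℤ)} {m : E → ℕ}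

lemma pushX_liftOf {A : Finset E} (x : V → ℤ) {t : E → ℕ} (ht : ∀ e ∉ A, t e < m e) :
    pushX ends m (liftOf m A x t) = x + chipsOff ends A := by
  ext v
  rw [pushX_apply, Pi.add_apply, chipsOff, Finset.sum_apply, ← Finset.sum_subset (subset_univ Aᶜ)]
  · congr 1
    refine Finset.sum_congr rfl fun e he => ?_
    rw [mem_compl] at he
    rw [Finset.sum_eq_single ⟨t e, ht e he⟩]
    · simp [liftOf, he, stdVec, eq_comm]
    · intro i _ hi
      have : (i : ℕ) ≠ t e := fun h => hi (Fin.ext h)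
      simp [liftOf, this]
    · simp
  · intro e _ he
    rw [mem_compl, not_not] at he
    simp [liftOf, he]

lemma pushQ_liftOf {A : Finset E} (x : V → ℤ) {t : E → ℕ} (ht : ∀ e ∉ A, t e < m e) (e : E) :
    pushQ m (liftOf m A x t) e = if e ∈ A then 0 else (m e : ℤ) - t e := by
  rw [pushQ_apply]
  split_ifs with he
  · simp [liftOf, he]
  · rw [Finset.sum_eq_single ⟨t e, ht e he⟩]
    · simp [liftOf, he]
    · intro i _ hi
      have : (i : ℕ) ≠ t e := fun h => hi (Fin.ext h)
      simp [liftOf, this]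
    · simp

lemma zeroSet_pushQ_liftOf {A : Finset E} (x : V → ℤ) {t : E → ℕ} (ht : ∀ e ∉ A, t e < m e) :
    zeroSet (pushQ m (liftOf m A x t)) = A := by
  ext e
  rw [mem_zeroSet, pushQ_liftOf x ht]
  have := ht e
  split_ifs with he
  · simp [he]
  · have := ht e he
    simp only [he, iff_false]
    omega

/-- Lifts are encoded by codes. -/
lemma isCode_of_mem_liftSet {D : SubV V E m → ℤ} (hD : D ∈ liftSet m σ) :
    IsCode ends σ m (pushX ends m D) (pushQ m D) := by
  obtain ⟨A, x, t, hx, ht, rfl⟩ := hD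
  refine ⟨fun e => ?_, ?_⟩
  · rw [pushQ_liftOf x ht]
    split_ifs with he
    · omega
    · have := ht e he
      omega
  · rwa [zeroSet_pushQ_liftOf x ht, pushX_liftOf x ht, add_sub_cancel_right]

lemma eq_of_mem_liftSet {D D' : SubV V E m → ℤ} (hD : D ∈ liftSet m σ) (hD' : D' ∈ liftSet m σ)
    (hX : pushX ends m D = pushX ends m D') (hq : pushQ m D = pushQ m D') : D = D' := by
  obtain ⟨A, x, t, hx, ht, rfl⟩ := hD
  obtain ⟨A', x', t', hx', ht', rfl⟩ := hD'
  obtain rfl : A = A' := by rw [← zeroSet_pushQ_liftOf x ht, hq, zeroSet_pushQ_liftOf x' ht']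
  rw [pushX_liftOf x ht, pushX_liftOf x' ht', add_left_inj] at hX
  subst hX
  have h : ∀ e ∉ A, t e = t' e := by
    intro e he
    have := congrFun hq e
    rw [pushQ_liftOf x ht, pushQ_liftOf x ht', if_neg he, if_neg he] at this
    omega
  ext w
  rcases w with v | ⟨e, i⟩
  · rfl
  · by_cases he : e ∈ A
    · simp [liftOf, he]
    · simp [liftOf, h e he]

lemma IsCode.exists_mem_liftSet {X : V → ℤ} {q : E → ℤ} (h : IsCode ends σ m X q) :
    ∃ D ∈ liftSet m σ, pushX ends m D = X ∧ pushQ m D = q := by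
  have ht : ∀ e ∉ zeroSet q, ((m e : ℤ) - q e).toNat < m e := by
    intro e he
    rw [mem_zeroSet] at he
    have := h.1 e
    omega
  refine ⟨_, ⟨zeroSet q, _, _, h.2, ht, rfl⟩, ?_, ?_⟩
  · rw [pushX_liftOf _ ht, sub_add_cancel]
  · ext e
    rw [pushQ_liftOf _ ht]
    have := h.1 e
    split_ifs with he
    · exact (mem_zeroSet.1 he).symm
    · omega

end Lift

/-- If `σ` is a degree-`d` stability assignment for a connected
multigraph `Γ`, then for every `m : Edges(Γ) → ℕ` the lift `σ̃_m` is a minimal complete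
set of representatives for the action of the twister group `tw(Γ̃_m)` on `S^d_{Γ̃_m}(Γ̃_m)`. -/
theorem statement1 (ends : E → V × V) (d : ℤ) (σ : Finset E → Set (V → ℤ))
    (hconn : Conn ends (Finset.univ : Finset E))
    (hσ : IsStabilityAssignment ends d σ) (m : E → ℕ) :
    IsRepSet (subEnds ends m) d (Finset.univ : Finset (SubE E m)) (liftSet m σ) := by
  have hdeg : ∀ D : SubV V E m → ℤ,
      D ∈ Sdeg (E := SubE E m) d univ ↔ ∑ v, pushX ends m D v = d := fun D => by
    simp [Sdeg, nG, sum_pushX]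
  refine ⟨fun D hD => (hdeg D).2 ((isCode_of_mem_liftSet hD).sum_eq hσ.1), fun D hD => ?_⟩
  obtain ⟨X', q', h', hrel⟩ := exists_isCode hconn hσ m (pushQ m D) ((hdeg D).1 hD)
  obtain ⟨D', hD', rfl, rfl⟩ := h'.exists_mem_liftSet
  have hDD' : D - D' ∈ twGroup (subEnds ends m) univ := by
    rwa [mem_twGroup_subEnds_iff, pushX_sub, pushQ_sub]
  refine ⟨D', ⟨hD', hDD'⟩, ?_⟩
  rintro D'' ⟨hD'', h''⟩
  have hdiff : D'' - D' ∈ twGroup (subEnds ends m) univ := by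
    rw [← sub_sub_sub_cancel_left _ _ D]
    exact sub_mem hDD' h''
  rw [mem_twGroup_subEnds_iff, pushX_sub, pushQ_sub] at hdiff
  obtain ⟨hX, hq⟩ := (isCode_of_mem_liftSet hD'').eq_of_subdivRel hconn hσ h' hdiff
  exact eq_of_mem_liftSet hD'' hD' hX hq
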